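/- Let A be a BV algebra over a commutative ring R, and define the Gerstenhaber bracket of homogeneous elements by {x,y} := (−1)^{|x|} D(x,y), where D(x,y) = Δ(x·y) − Δx·y − (−1)^{|x|} x·Δy is the deviation of Δ from being a derivation. Then for all homogeneous x, y, z: (i) graded antisymmetry holds: {x,y} = −(−1)^{(|x|+1)(|y|+1)} {y,x}; (ii) the graded Leibniz rule holds: {x, y·z} = {x,y}·z + (−1)^{(|x|+1)|y|} y·{x,z}; and (iii) the graded Jacobi identity holds: {x,{y,z}} = {{x,y},z} + (−1)^{(|x|+1)(|y|+1)} {y,{x,z}}. Hence (A, ·, {,}) is a Gerstenhaber (odd Poisson) algebra. -/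

import Mathlib

/-- The sign `(−1)^n` for `n : ℤ`, as an integer. -/
def sgn (n : ℤ) : ℤ := (((-1 : ℤˣ) ^ n : ℤˣ) : ℤ)

/-- A Batalin–Vilkovisky (BV) algebra over a commutative ring `R`: a ℤ-graded
`R`-module `A` (the grading given by submodules `deg i`), with an `R`-bilinear,
associative, unital, graded-commutative product of degree `0`, and an `R`-linear
operator `Δ` of degree `+1` with `Δ ∘ Δ = 0`, such that the deviation
`D(x,y) := Δ(x·y) − Δx·y − (−1)^{|x|} x·Δy` of `Δ` from being a derivation is
itself a graded derivation in each variable. -/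
structure GradedBV (R A : Type*) [CommRing R] [AddCommGroup A] [Module R A] where
  deg : ℤ → Submodule R A
  mul : A →ₗ[R] A →ₗ[R] A
  one : A
  Δ : A →ₗ[R] A
  mul_mem : ∀ {i j : ℤ} {x y : A}, x ∈ deg i → y ∈ deg j → mul x y ∈ deg (i + j)
  Δ_mem : ∀ {i : ℤ} {x : A}, x ∈ deg i → Δ x ∈ deg (i + 1)
  mul_assoc' : ∀ x y z : A, mul (mul x y) z = mul x (mul y z)
  one_mul' : ∀ x : A, mul one x = x
  mul_one' : ∀ x : A, mul x one = x
  mul_comm' : ∀ {i j : ℤ} {x y : A}, x ∈ deg i → y ∈ deg j →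
    mul x y = sgn (i * j) • mul y x
  Δ_sq : ∀ x : A, Δ (Δ x) = 0
  deviation_deriv : ∀ {i j k : ℤ} {x y z : A}, x ∈ deg i → y ∈ deg j → z ∈ deg k →
    (Δ (mul x (mul y z)) - mul (Δ x) (mul y z) - sgn i • mul x (Δ (mul y z)))
      = mul (Δ (mul x y) - mul (Δ x) y - sgn i • mul x (Δ y)) z
        + sgn ((i + 1) * j) •
            mul y (Δ (mul x z) - mul (Δ x) z - sgn i • mul x (Δ z))

/-- The deviation `D(x,y) = Δ(x·y) − Δx·y − (−1)^{|x|} x·Δy` of `Δ` from being a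
derivation, for `x` homogeneous of degree `i`. -/
def GradedBV.D {R A : Type*} [CommRing R] [AddCommGroup A] [Module R A]
    (S : GradedBV R A) (i : ℤ) (x y : A) : A :=
  S.Δ (S.mul x y) - S.mul (S.Δ x) y - sgn i • S.mul x (S.Δ y)

/-- The Gerstenhaber bracket `{x,y} := (−1)^{|x|} D(x,y)`, for `x` homogeneous of
degree `i`. -/
def GradedBV.bracket {R A : Type*} [CommRing R] [AddCommGroup A] [Module R A]
    (S : GradedBV R A) (i : ℤ) (x y : A) : A :=
  sgn i • S.D i x y

theorem sgn_even {n : ℤ} (h : Even n) : sgn n = 1 := by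
  simp [sgn, h.neg_one_zpow]

theorem sgn_odd {n : ℤ} (h : Odd n) : sgn n = -1 := by
  obtain ⟨m, rfl⟩ := h
  simp [sgn, zpow_add, zpow_mul]

theorem sgn_add (m n : ℤ) : sgn (m + n) = sgn m * sgn n := by
  simp [sgn, zpow_add]

theorem sgn_cases (i j : ℤ) :
    (sgn i = 1 ∨ sgn i = -1) ∧ (sgn j = 1 ∨ sgn j = -1) ∧
    (sgn (i * j) = 1 ∨ sgn (i * j) = -1) := by
  have h : ∀ n, sgn n = 1 ∨ sgn n = -1 := fun n =>
    (Int.even_or_odd n).imp sgn_even sgn_odd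
  exact ⟨h _, h _, h _⟩

theorem sgn_one : sgn 1 = -1 := sgn_odd odd_one

namespace GradedBV
variable {R A : Type*} [CommRing R] [AddCommGroup A] [Module R A] (S : GradedBV R A)

theorem D_mem {i j : ℤ} {x y : A} (hx : x ∈ S.deg i) (hy : y ∈ S.deg j) :
    S.D i x y ∈ S.deg (i + j + 1) := by
  unfold D
  refine Submodule.sub_mem _ (Submodule.sub_mem _ (S.Δ_mem (S.mul_mem hx hy)) ?_)
    (zsmul_mem ?_ _)
  · have := S.mul_mem (S.Δ_mem hx) hy
    rwa [show i + 1 + j = i + j + 1 by ring] at this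
  · have := S.mul_mem hx (S.Δ_mem hy)
    rwa [← add_assoc] at this

theorem D_symm {i j : ℤ} {x y : A} (hx : x ∈ S.deg i) (hy : y ∈ S.deg j) :
    S.D j y x = sgn (i * j) • S.D i x y := by
  have h1 := S.mul_comm' hy hx
  have h2 := S.mul_comm' (S.Δ_mem hy) hx
  have h3 := S.mul_comm' hy (S.Δ_mem hx)
  unfold D
  rw [h1, h2, h3]
  simp only [add_mul, mul_add, one_mul, mul_one, sgn_add, mul_comm j i, map_zsmul]
  obtain ⟨h | h, h' | h', h'' | h''⟩ := sgn_cases i j <;> rw [h, h', h''] <;> module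

theorem D_leib {i j k : ℤ} {x y z : A}
    (hx : x ∈ S.deg i) (hy : y ∈ S.deg j) (hz : z ∈ S.deg k) :
    S.D i x (S.mul y z) = S.mul (S.D i x y) z + sgn ((i + 1) * j) • S.mul y (S.D i x z) :=
  S.deviation_deriv hx hy hz

theorem Δ_D {i : ℤ} {x y : A} :
    S.Δ (S.D i x y) = - S.D (i + 1) (S.Δ x) y - sgn i • S.D i x (S.Δ y) := by
  simp only [D, map_sub, map_zsmul, S.Δ_sq, sgn_add, sgn_one, map_zero, LinearMap.zero_apply]
  obtain ⟨h | h, -, -⟩ := sgn_cases i i <;> rw [h] <;> module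

theorem Δ_mul (i : ℤ) (x y : A) :
    S.Δ (S.mul x y) = S.D i x y + S.mul (S.Δ x) y + sgn i • S.mul x (S.Δ y) := by
  unfold D; module

theorem D_sub (i : ℤ) (x y z : A) : S.D i x (y - z) = S.D i x y - S.D i x z := by
  simp only [D, map_sub]; module

theorem D_zsmul (i n : ℤ) (x y : A) : S.D i x (n • y) = n • S.D i x y := by
  simp only [D, map_zsmul, smul_sub, smul_comm n]

theorem D_zsmul_left (i n : ℤ) (x y : A) : S.D i (n • x) y = n • S.D i x y := by
  simp only [D, map_zsmul, smul_sub, smul_comm n, LinearMap.smul_apply]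

theorem D_jac {i j k : ℤ} {x y z : A}
    (hx : x ∈ S.deg i) (hy : y ∈ S.deg j) (hz : z ∈ S.deg k) :
    S.D i x (S.D j y z) = - sgn i • S.D (i + j + 1) (S.D i x y) z
      - sgn (i * j + i + j) • S.D j y (S.D i x z) := by
  have e1 := S.Δ_D (i := i) (x := x) (y := S.mul y z)
  rw [S.D_leib hx hy hz, S.D_leib (S.Δ_mem hx) hy hz, S.Δ_mul j y z, map_add, map_zsmul,
    S.Δ_mul (i + j + 1) (S.D i x y) z, S.Δ_mul j y, S.Δ_D, S.Δ_D] at e1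
  have e2 := S.D_leib hx (S.Δ_mem hy) hz
  have e3 := S.D_leib hx hy (S.Δ_mem hz)
  have e4 : S.D i x (S.D j y z + S.mul (S.Δ y) z + sgn j • S.mul y (S.Δ z)) =
      S.D i x (S.D j y z) + S.D i x (S.mul (S.Δ y) z) + sgn j • S.D i x (S.mul y (S.Δ z)) := by
    rw [← D_zsmul]; simp only [D, map_add]; module
  rw [e4, e2, e3] at e1
  simp only [add_mul, mul_add, one_mul, mul_one, sgn_add, sgn_one, map_sub, map_neg, map_zsmul,
    LinearMap.sub_apply, LinearMap.neg_apply, LinearMap.smul_apply] at e1 ⊢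
  obtain ⟨h | h, h' | h', h'' | h''⟩ := sgn_cases i j <;> rw [h, h', h''] at e1 <;>
    rw [h, h', h''] <;> rw [← sub_eq_zero] at e1 ⊢ <;>
    first
    | (rw [← e1]; module)
    | (rw [← neg_eq_zero, ← e1]; module)

end GradedBV

/-- In a BV algebra, the Gerstenhaber bracket `{x,y} = (−1)^{|x|} D(x,y)` is graded
antisymmetric, satisfies the graded Leibniz rule, and satisfies the graded Jacobi
identity; hence `(A, ·, {,})` is a Gerstenhaber (odd Poisson) algebra. -/
theorem gerstenhaber_of_BV {R A : Type*} [CommRing R] [AddCommGroup A] [Module R A]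
    (S : GradedBV R A) {i j k : ℤ} {x y z : A}
    (hx : x ∈ S.deg i) (hy : y ∈ S.deg j) (hz : z ∈ S.deg k) :
    S.bracket i x y = -(sgn ((i + 1) * (j + 1)) • S.bracket j y x) ∧
    S.bracket i x (S.mul y z)
      = S.mul (S.bracket i x y) z + sgn ((i + 1) * j) • S.mul y (S.bracket i x z) ∧
    S.bracket i x (S.bracket j y z)
      = S.bracket (i + j + 1) (S.bracket i x y) z
        + sgn ((i + 1) * (j + 1)) • S.bracket j y (S.bracket i x z) := by
  refine ⟨?_, ?_, ?_⟩
  · unfold GradedBV.bracket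
    rw [S.D_symm hx hy]
    simp only [add_mul, mul_add, one_mul, mul_one, sgn_add, sgn_one]
    obtain ⟨h | h, h' | h', h'' | h''⟩ := sgn_cases i j <;> rw [h, h', h''] <;> module
  · unfold GradedBV.bracket
    rw [S.D_leib hx hy hz]
    simp only [map_zsmul, LinearMap.smul_apply]
    module
  · unfold GradedBV.bracket
    rw [S.D_zsmul, S.D_zsmul, S.D_zsmul_left, S.D_jac hx hy hz]
    simp only [add_mul, mul_add, one_mul, mul_one, sgn_add, sgn_one]
    obtain ⟨h | h, h' | h', h'' | h''⟩ := sgn_cases i j <;> rw [h, h', h''] <;> module
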